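/- arXiv:1406.1582 — 3 statements merged into one kernel-verified Lean document; each statement's English description precedes it below -/
import Mathlib

section
/- Reflection for negated formulas: for every formula A, IEL ⊢ K¬A → ¬A. -/
/-- Formulas of intuitionistic epistemic logic: atoms, ⊥, ∧, ∨, →, and the
epistemic operator `K`. `¬A` abbreviates `A → ⊥`. -/
inductive Formula : Type
  | atom : ℕ → Formula
  | bot  : Formula
  | and  : Formula → Formula → Formula
  | or   : Formula → Formula → Formula
  | imp  : Formula → Formula → Formula
  | K    : Formula → Formula

namespace Formula
def neg (A : Formula) : Formula := A.imp bot
def iff (A B : Formula) : Formula := (A.imp B).and (B.imp A)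
end Formula

open Formula

/-- Hilbert-style derivability. `Deriv false` is IEL⁻ (intuitionistic
propositional axioms, distribution `K(A→B) → (KA→KB)`, co-reflection `A → KA`,
modus ponens); `Deriv true` is IEL, which additionally has intuitionistic
reflection `KA → ¬¬A`. -/
inductive Deriv : Bool → Formula → Prop
  | a1 {b : Bool} {A B : Formula} : Deriv b (A.imp (B.imp A))
  | a2 {b : Bool} {A B C : Formula} :
      Deriv b ((A.imp (B.imp C)).imp ((A.imp B).imp (A.imp C)))
  | a3 {b : Bool} {A B : Formula} : Deriv b ((A.and B).imp A)
  | a4 {b : Bool} {A B : Formula} : Deriv b ((A.and B).imp B)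
  | a5 {b : Bool} {A B : Formula} : Deriv b (A.imp (B.imp (A.and B)))
  | a6 {b : Bool} {A B : Formula} : Deriv b (A.imp (A.or B))
  | a7 {b : Bool} {A B : Formula} : Deriv b (B.imp (A.or B))
  | a8 {b : Bool} {A B C : Formula} :
      Deriv b ((A.imp C).imp ((B.imp C).imp ((A.or B).imp C)))
  | a9 {b : Bool} {A : Formula} : Deriv b (Formula.bot.imp A)
  | dist {b : Bool} {A B : Formula} :
      Deriv b ((K (A.imp B)).imp ((K A).imp (K B)))
  | coref {b : Bool} {A : Formula} : Deriv b (A.imp (K A))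
  | ir {A : Formula} : Deriv true ((K A).imp A.neg.neg)
  | mp {b : Bool} {A B : Formula} : Deriv b (A.imp B) → Deriv b A → Deriv b B

namespace Deriv

variable {b : Bool} {A B C : Formula}

theorem imp_trans (hAB : Deriv b (A.imp B)) (hBC : Deriv b (B.imp C)) :
    Deriv b (A.imp C) :=
  mp (mp a2 (mp a1 hBC)) hAB

theorem imp_refl : Deriv b (A.imp A) :=
  mp (mp a2 a1) (a1 (B := A))

theorem neg_neg_intro : Deriv b (A.imp A.neg.neg) :=
  imp_trans a1 (mp a2 (imp_refl (A := A.neg)))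

theorem neg_imp_neg (h : Deriv b (A.imp B)) : Deriv b (B.neg.imp A.neg) :=
  mp (mp a2 (imp_trans a1 a2)) (mp a1 h)

end Deriv

theorem reflection_for_negations : ∀ A : Formula,
    Deriv true ((K A.neg).imp A.neg) :=
  fun _ => Deriv.imp_trans Deriv.ir (Deriv.neg_imp_neg Deriv.neg_neg_intro)
end

section
/- Impossibility of verification is equivalent to impossibility of proof: for every formula A, IEL ⊢ ¬K A ↔ ¬A. -/
open Formula

namespace Deriv

theorem imp_trans_s13 {b : Bool} {A B C : Formula} (h₁ : Deriv b (A.imp B))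
    (h₂ : Deriv b (B.imp C)) : Deriv b (A.imp C) :=
  mp (mp a2 (mp a1 h₂)) h₁

theorem imp_swap {b : Bool} {A B C : Formula} (h : Deriv b (A.imp (B.imp C))) :
    Deriv b (B.imp (A.imp C)) :=
  imp_trans_s13 a1 (mp a2 h)

theorem contrapose {b : Bool} {A B : Formula} (h : Deriv b (A.imp B)) :
    Deriv b (B.neg.imp A.neg) :=
  mp (imp_swap (imp_trans_s13 a1 a2)) h

end Deriv

theorem not_K_iff_not : ∀ A : Formula,
    Deriv true (Formula.iff (K A).neg A.neg) := by
  intro A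
  exact .mp (.mp .a5 (Deriv.contrapose .coref)) (Deriv.imp_swap .ir)
end

section
/- Disjunction property: for L ∈ {IEL⁻, IEL} and all formulas A, B, if L ⊢ A ∨ B then L ⊢ A or L ⊢ B. -/
open Formula

/-- The Aczel slash relative to derivability in `Deriv b`. Atoms, `⊥` and `K`-formulas
are slashed exactly when they are derivable. -/
def Slash (b : Bool) : Formula → Prop
  | .atom n => Deriv b (.atom n)
  | .bot => Deriv b .bot
  | .and A B => Slash b A ∧ Slash b B
  | .or A B => Slash b A ∨ Slash b B
  | .imp A B => Deriv b (A.imp B) ∧ (Slash b A → Slash b B)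
  | .K A => Deriv b (.K A)

theorem Slash.deriv {b : Bool} : ∀ {A : Formula}, Slash b A → Deriv b A
  | .atom _, h => h
  | .bot, h => h
  | .and _ _, h => .mp (.mp .a5 h.1.deriv) h.2.deriv
  | .or _ _, h => h.elim (fun h => .mp .a6 h.deriv) (fun h => .mp .a7 h.deriv)
  | .imp _ _, h => h.1
  | .K _, h => h

theorem Slash.of_deriv_bot {b : Bool} (h : Deriv b .bot) : ∀ A : Formula, Slash b A
  | .atom _ => .mp .a9 h
  | .bot => h
  | .and A B => ⟨of_deriv_bot h A, of_deriv_bot h B⟩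
  | .or A _ => Or.inl (of_deriv_bot h A)
  | .imp _ B => ⟨.mp .a9 h, fun _ => of_deriv_bot h B⟩
  | .K _ => .mp .a9 h

theorem Deriv.slash {b : Bool} {A : Formula} (h : Deriv b A) : Slash b A := by
  induction h with
  | a1 => exact ⟨.a1, fun hA => ⟨.mp .a1 hA.deriv, fun _ => hA⟩⟩
  | a2 =>
    exact ⟨.a2, fun h => ⟨.mp .a2 h.1, fun g =>
      ⟨.mp (.mp .a2 h.1) g.1, fun hA => (h.2 hA).2 (g.2 hA)⟩⟩⟩
  | a3 => exact ⟨.a3, fun h => h.1⟩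
  | a4 => exact ⟨.a4, fun h => h.2⟩
  | a5 => exact ⟨.a5, fun hA => ⟨.mp .a5 hA.deriv, fun hB => ⟨hA, hB⟩⟩⟩
  | a6 => exact ⟨.a6, Or.inl⟩
  | a7 => exact ⟨.a7, Or.inr⟩
  | a8 =>
    exact ⟨.a8, fun f => ⟨.mp .a8 f.1, fun g => ⟨.mp (.mp .a8 f.1) g.1, fun h => h.elim f.2 g.2⟩⟩⟩
  | a9 => exact ⟨.a9, fun h => .of_deriv_bot h _⟩
  | dist => exact ⟨.dist, fun h => ⟨.mp .dist h, fun g => .mp (.mp .dist h) g⟩⟩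
  | coref => exact ⟨.coref, fun hA => .mp .coref hA.deriv⟩
  | ir => exact ⟨.ir, fun h => ⟨.mp .ir h, fun g => .mp (.mp .ir h) g.1⟩⟩
  | mp _ _ ihf ihA => exact ihf.2 ihA

theorem disjunction_property : ∀ (b : Bool) (A B : Formula),
    Deriv b (A.or B) → Deriv b A ∨ Deriv b B := by
  intro b A B h
  exact Or.imp Slash.deriv Slash.deriv h.slash
end
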